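/- arXiv:2210.07403 — 3 statements merged into one kernel-verified Lean document; each statement's English description precedes it below -/
import Mathlib

section
/- Let c ∈ ℝ², r > 0, and let x₀ ∈ ℝ² satisfy ‖x₀ − c‖ < r. Then the outward flux of the gradient of the free-space Laplace Green's function with singularity at x₀ through the circle of radius r centered at c equals −1: ∫₀^{2π} ∇G(c + r e(θ)) · e(θ) r dθ = −1, where G(x) = −(1/(2π)) log‖x − x₀‖. -/
/-- Partial derivative with respect to the first variable. -/
noncomputable def pd1 (f : ℝ → ℝ → ℝ) (x y : ℝ) : ℝ := deriv (fun t => f t y) x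

/-- Partial derivative with respect to the second variable. -/
noncomputable def pd2 (f : ℝ → ℝ → ℝ) (x y : ℝ) : ℝ := deriv (fun t => f x t) y

/-- Two-dimensional free-space Green's function for Laplace's equation with
singularity at `(a, b)`: `G(x) = −(1/(2π)) log‖x − x₀‖`. -/
noncomputable def greenFn (a b : ℝ) (x y : ℝ) : ℝ :=
  -(1 / (2 * Real.pi)) * Real.log (Real.sqrt ((x - a) ^ 2 + (y - b) ^ 2))

theorem pd1_greenFn {a b x y : ℝ} (h : (x - a) ^ 2 + (y - b) ^ 2 ≠ 0) :
    pd1 (greenFn a b) x y =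
      -(1 / (2 * Real.pi)) * ((x - a) / ((x - a) ^ 2 + (y - b) ^ 2)) := by
  have hd : HasDerivAt (fun t : ℝ => (t - a) ^ 2 + (y - b) ^ 2) (2 * (x - a)) x := by
    simpa using (((hasDerivAt_id x).sub_const a).pow 2).add_const ((y - b) ^ 2)
  have hlog : HasDerivAt (fun t : ℝ => greenFn a b t y)
      (-(1 / (2 * Real.pi)) * (2 * (x - a) / ((x - a) ^ 2 + (y - b) ^ 2) / 2)) x := by
    refine (((hd.log h).div_const 2).const_mul (-(1 / (2 * Real.pi)))).congr_of_eventuallyEq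
      (Filter.Eventually.of_forall fun t => ?_)
    simp only [greenFn]
    rw [Real.log_sqrt (by positivity)]
  rw [pd1, hlog.deriv]
  ring

theorem greenFn_swap (a b x y : ℝ) : greenFn a b x y = greenFn b a y x := by
  simp only [greenFn, add_comm]

theorem pd2_greenFn {a b x y : ℝ} (h : (x - a) ^ 2 + (y - b) ^ 2 ≠ 0) :
    pd2 (greenFn a b) x y =
      -(1 / (2 * Real.pi)) * ((y - b) / ((x - a) ^ 2 + (y - b) ^ 2)) := by
  have hswap : pd2 (greenFn a b) x y = pd1 (greenFn b a) y x := by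
    simp only [pd1, pd2, greenFn_swap a b]
  rw [hswap, pd1_greenFn (by rwa [add_comm]), add_comm ((y - b) ^ 2)]

/-- The outward normal derivative of `log ‖x - x₀‖` on a circle, times the radius, is the
imaginary part of the Cauchy kernel pulled back along the parametrization of that circle. -/
theorem im_deriv_circleMap_mul_inv (c₁ c₂ a b r θ : ℝ) :
    (deriv (circleMap ⟨c₁, c₂⟩ r) θ * (circleMap ⟨c₁, c₂⟩ r θ - ⟨a, b⟩)⁻¹).im =
      ((c₁ + r * Real.cos θ - a) * Real.cos θ + (c₂ + r * Real.sin θ - b) * Real.sin θ) * r /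
        ((c₁ + r * Real.cos θ - a) ^ 2 + (c₂ + r * Real.sin θ - b) ^ 2) := by
  have hexp : Complex.exp (θ * Complex.I) = ⟨Real.cos θ, Real.sin θ⟩ := by
    apply Complex.ext <;> simp [Complex.exp_ofReal_mul_I_re, Complex.exp_ofReal_mul_I_im]
  simp only [deriv_circleMap, circleMap, hexp, Complex.mul_im, Complex.mul_re, Complex.inv_re,
    Complex.inv_im, Complex.normSq_apply, Complex.sub_re, Complex.sub_im, Complex.add_re,
    Complex.add_im, Complex.ofReal_re, Complex.ofReal_im, Complex.I_re, Complex.I_im,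
    Complex.zero_re, Complex.zero_im]
  ring_nf

/-- A point strictly inside a circle does not lie on it. -/
theorem circle_sub_sq_add_sq_ne_zero {c₁ c₂ a b r : ℝ} (hr : 0 < r)
    (hin : Real.sqrt ((a - c₁) ^ 2 + (b - c₂) ^ 2) < r) (θ : ℝ) :
    (c₁ + r * Real.cos θ - a) ^ 2 + (c₂ + r * Real.sin θ - b) ^ 2 ≠ 0 := by
  intro h
  rw [Real.sqrt_lt' hr] at hin
  have h₁ : a - c₁ = r * Real.cos θ := by nlinarith
  have h₂ : b - c₂ = r * Real.sin θ := by nlinarith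
  rw [h₁, h₂] at hin
  nlinarith [Real.sin_sq_add_cos_sq θ]

/-- If the singularity `x₀ = (a, b)` lies strictly inside the circle of radius `r`
centered at `c = (c₁, c₂)`, then the outward flux of `∇G` through that circle is `−1`. -/
theorem greenFn_flux_circle_singularity_inside (c₁ c₂ a b r : ℝ) (hr : 0 < r)
    (hin : Real.sqrt ((a - c₁) ^ 2 + (b - c₂) ^ 2) < r) :
    (∫ θ in (0:ℝ)..(2 * Real.pi),
      (pd1 (greenFn a b) (c₁ + r * Real.cos θ) (c₂ + r * Real.sin θ) * Real.cos θ +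
        pd2 (greenFn a b) (c₁ + r * Real.cos θ) (c₂ + r * Real.sin θ) * Real.sin θ) * r)
      = -1 := by
  have hw : (⟨a, b⟩ : ℂ) ∈ Metric.ball (⟨c₁, c₂⟩ : ℂ) r := by
    simpa [Complex.dist_eq_re_im] using hin
  have hinv : CircleIntegrable (fun z : ℂ => (z - ⟨a, b⟩)⁻¹) ⟨c₁, c₂⟩ r := by
    rw [circleIntegrable_sub_inv_iff]
    right
    rw [abs_of_pos hr]
    exact fun h => (Metric.mem_ball.mp hw).ne (Metric.mem_sphere.mp h)
  have hcauchy : ∫ θ in (0 : ℝ)..(2 * Real.pi),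
      (deriv (circleMap ⟨c₁, c₂⟩ r) θ * (circleMap ⟨c₁, c₂⟩ r θ - ⟨a, b⟩)⁻¹).im =
        2 * Real.pi := by
    have him := Complex.imCLM.intervalIntegral_comp_comm hinv.out
    have hval := circleIntegral.integral_sub_inv_of_mem_ball hw
    simp only [circleIntegral, smul_eq_mul] at hval
    simp only [smul_eq_mul, Complex.imCLM_apply, hval] at him
    simpa using him
  have hflux : ∀ θ : ℝ,
      (pd1 (greenFn a b) (c₁ + r * Real.cos θ) (c₂ + r * Real.sin θ) * Real.cos θ +
        pd2 (greenFn a b) (c₁ + r * Real.cos θ) (c₂ + r * Real.sin θ) * Real.sin θ) * r =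
      -(1 / (2 * Real.pi)) *
        (deriv (circleMap ⟨c₁, c₂⟩ r) θ * (circleMap ⟨c₁, c₂⟩ r θ - ⟨a, b⟩)⁻¹).im := by
    intro θ
    have h := circle_sub_sq_add_sq_ne_zero hr hin θ
    rw [pd1_greenFn h, pd2_greenFn h, im_deriv_circleMap_mul_inv]
    ring
  simp only [hflux]
  rw [intervalIntegral.integral_const_mul, hcauchy]
  field_simp
end

section
/- For every x₀ ∈ ℝ², every ε > 0, and all i, j ∈ {1,2}, the flux of the two-dimensional free-space Stresslet through the upper half of the circle of radius ε centered at its singularity, taken with respect to the inward normal −e(θ), equals (1/2)δ_ij: ∑_{k=1}^{2} ∫₀^{π} T_ijk(x₀ + ε e(θ)) (−e(θ))_k ε dθ = (1/2) δ_ij. -/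
/-- The Kronecker delta on `Fin 2`, valued in `ℝ`. -/
noncomputable def kron (i j : Fin 2) : ℝ := if i = j then 1 else 0

/-- Component `i` of `x̂ = x − x₀` where `x = (x, y)` and `x₀ = (a, b)`. -/
noncomputable def xhat (a b : ℝ) (i : Fin 2) (x y : ℝ) : ℝ := if i = 0 then x - a else y - b

/-- The two-dimensional free-space Stresslet with singularity at `(a, b)`:
`T_ijk(x) = −x̂_i x̂_j x̂_k / (π‖x̂‖⁴)`. -/
noncomputable def stresslet (a b : ℝ) (i j k : Fin 2) (x y : ℝ) : ℝ :=
  -(xhat a b i x y * xhat a b j x y * xhat a b k x y) /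
    (Real.pi * ((x - a) ^ 2 + (y - b) ^ 2) ^ 2)

/-- Component `k` of the unit vector `e(θ) = (cos θ, sin θ)`. -/
noncomputable def evec (k : Fin 2) (θ : ℝ) : ℝ := if k = 0 then Real.cos θ else Real.sin θ

theorem continuous_evec (k : Fin 2) : Continuous (evec k) := by
  unfold evec
  split_ifs
  exacts [Real.continuous_cos, Real.continuous_sin]

theorem sum_evec_sq (θ : ℝ) : ∑ k : Fin 2, evec k θ ^ 2 = 1 := by
  simp [evec]

theorem xhat_circle (a b ε : ℝ) (i : Fin 2) (θ : ℝ) :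
    xhat a b i (a + ε * Real.cos θ) (b + ε * Real.sin θ) = ε * evec i θ := by
  unfold xhat evec
  split_ifs <;> ring

/-- On a circle centered at the singularity, the Stresslet traction density with respect to the
inward normal does not depend on the radius. -/
theorem stresslet_circle_mul_normal (a b : ℝ) {ε : ℝ} (hε : ε ≠ 0) (i j k : Fin 2) (θ : ℝ) :
    stresslet a b i j k (a + ε * Real.cos θ) (b + ε * Real.sin θ) * (-(evec k θ)) * ε
      = Real.pi⁻¹ * (evec i θ * evec j θ) * evec k θ ^ 2 := by
  have hr : (a + ε * Real.cos θ - a) ^ 2 + (b + ε * Real.sin θ - b) ^ 2 = ε ^ 2 := by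
    linear_combination ε ^ 2 * Real.sin_sq_add_cos_sq θ
  rw [stresslet, hr, xhat_circle, xhat_circle, xhat_circle]
  field_simp

theorem integral_evec_mul_evec (i j : Fin 2) :
    ∫ θ in (0:ℝ)..Real.pi, evec i θ * evec j θ = Real.pi / 2 * kron i j := by
  fin_cases i <;> fin_cases j
  · simp [evec, kron, ← sq, integral_cos_sq]
  · simp [evec, kron, mul_comm (Real.cos _), integral_sin_mul_cos₁]
  · simp [evec, kron, integral_sin_mul_cos₁]
  · simp [evec, kron, ← sq, integral_sin_sq]

/-- The flux of the free-space Stresslet through the upper half of the circle of radius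
`ε` centered at its singularity, with respect to the inward normal `−e(θ)`, equals
`(1/2) δ_ij`:  `∑ₖ ∫₀^{π} T_ijk(x₀ + ε e(θ)) (−e(θ))ₖ ε dθ = (1/2) δ_ij`. -/
theorem stresslet_flux_upper_semicircle (a b ε : ℝ) (hε : 0 < ε) (i j : Fin 2) :
    (∑ k : Fin 2, ∫ θ in (0:ℝ)..Real.pi,
      stresslet a b i j k (a + ε * Real.cos θ) (b + ε * Real.sin θ) * (-(evec k θ)) * ε)
      = (1 / 2) * kron i j := by
  simp_rw [stresslet_circle_mul_normal a b hε.ne']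
  have hint (k : Fin 2) : IntervalIntegrable
      (fun θ => Real.pi⁻¹ * (evec i θ * evec j θ) * evec k θ ^ 2) MeasureTheory.volume 0 Real.pi :=
    Continuous.intervalIntegrable ((continuous_const.mul
      ((continuous_evec i).mul (continuous_evec j))).mul ((continuous_evec k).pow 2)) _ _
  rw [← intervalIntegral.integral_finsetSum fun k _ => hint k]
  simp_rw [← Finset.mul_sum, sum_evec_sq, mul_one]
  rw [intervalIntegral.integral_const_mul, integral_evec_mul_evec]
  field_simp
end

section
/- Let c ∈ ℝ², r > 0, and let x₀ ∈ ℝ² satisfy ‖x₀ − c‖ < r. Then for all i, j ∈ {1,2}, the outward flux of the two-dimensional free-space Stresslet with singularity at x₀ through the circle of radius r centered at c equals −δ_ij: ∑_{k=1}^{2} ∫₀^{2π} T_ijk(c + r e(θ)) e(θ)_k r dθ = −δ_ij. -/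
open Real in
/-- The radial component of a point on a circle enclosing the origin is positive. -/
lemma radial_pos {p q r : ℝ} (h : √(p ^ 2 + q ^ 2) < r) (θ : ℝ) :
    0 < (p + r * cos θ) * cos θ + (q + r * sin θ) * sin θ := by
  have h1 := cos_sq_add_sin_sq θ
  have h2 : |p * cos θ + q * sin θ| ≤ √(p ^ 2 + q ^ 2) := by
    apply abs_le_sqrt
    nlinarith [sq_nonneg (p * sin θ - q * cos θ)]
  have h3 := (abs_le.mp h2).1
  linear_combination h3 + h - r * h1

open Real in
lemma normSq_circle_pos {p q r : ℝ} (h : √(p ^ 2 + q ^ 2) < r) (θ : ℝ) :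
    0 < (p + r * cos θ) ^ 2 + (q + r * sin θ) ^ 2 := by
  have h1 := cos_sq_add_sin_sq θ
  have hU := radial_pos h θ
  have h2 := pow_pos hU 2
  nlinarith [sq_nonneg ((q + r * sin θ) * cos θ - (p + r * cos θ) * sin θ)]

open Real in
/-- A continuous branch of the polar angle along a circle enclosing the origin. -/
noncomputable def circlePolarAngle (p q r θ : ℝ) : ℝ :=
  θ + arctan (((q + r * sin θ) * cos θ - (p + r * cos θ) * sin θ) /
    ((p + r * cos θ) * cos θ + (q + r * sin θ) * sin θ))

open Real in
lemma hasDerivAt_circlePolarAngle {p q r : ℝ} (h : √(p ^ 2 + q ^ 2) < r) (θ : ℝ) :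
    HasDerivAt (circlePolarAngle p q r)
      (r * ((p + r * cos θ) * cos θ + (q + r * sin θ) * sin θ) /
        ((p + r * cos θ) ^ 2 + (q + r * sin θ) ^ 2)) θ := by
  have hU := radial_pos h θ
  have hD := normSq_circle_pos h θ
  have h1 := cos_sq_add_sin_sq θ
  have hX : HasDerivAt (fun t => p + r * cos t) (r * -sin θ) θ :=
    ((hasDerivAt_cos θ).const_mul r).const_add p
  have hY : HasDerivAt (fun t => q + r * sin t) (r * cos θ) θ :=
    ((hasDerivAt_sin θ).const_mul r).const_add q
  have hN := (hY.mul (hasDerivAt_cos θ)).sub (hX.mul (hasDerivAt_sin θ))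
  have hR := (hX.mul (hasDerivAt_cos θ)).add (hY.mul (hasDerivAt_sin θ))
  have key := (hasDerivAt_id θ).add (hN.div hR hU.ne').arctan
  refine key.congr_deriv ?_
  simp only [Pi.add_apply, Pi.sub_apply, Pi.mul_apply, Pi.div_apply]
  set C := cos θ
  set S := sin θ
  set U := (p + r * C) * C + (q + r * S) * S with hUdef
  set V := (q + r * S) * C - (p + r * C) * S with hVdef
  have hUV : (p + r * C) ^ 2 + (q + r * S) ^ 2 = U ^ 2 + V ^ 2 := by
    rw [hUdef, hVdef]
    linear_combination (-(p + r * C) ^ 2 - (q + r * S) ^ 2) * h1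
  have hV' : r * C * C + (q + r * S) * -S - (r * -S * S + (p + r * C) * C) = r - U := by
    rw [hUdef]
    linear_combination r * h1
  have hU' : r * -S * C + (p + r * C) * -S + (r * C * S + (q + r * S) * C) = V := by
    rw [hVdef]
    ring
  rw [hUV] at hD ⊢
  rw [hV', hU']
  have hD' : 1 + (V / U) ^ 2 = (U ^ 2 + V ^ 2) / U ^ 2 := by
    field_simp
  rw [hD']
  field_simp
  ring

/-- Derivative of `cos φ sin φ`, where `φ` is the polar angle of `(X, Y)`. -/
lemma HasDerivAt.mul_div_normSq {X Y : ℝ → ℝ} {X' Y' t : ℝ} (hX : HasDerivAt X X' t)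
    (hY : HasDerivAt Y Y' t) (h : X t ^ 2 + Y t ^ 2 ≠ 0) :
    HasDerivAt (fun s => X s * Y s / (X s ^ 2 + Y s ^ 2))
      ((X t ^ 2 - Y t ^ 2) * (X t * Y' - Y t * X') / (X t ^ 2 + Y t ^ 2) ^ 2) t := by
  refine ((hX.mul hY).div ((hX.pow 2).add (hY.pow 2)) h).congr_deriv ?_
  simp only [Pi.add_apply, Pi.mul_apply, Pi.pow_apply]
  congr 1
  push_cast
  ring

/-- Derivative of `sin² φ`, where `φ` is the polar angle of `(X, Y)`. -/
lemma HasDerivAt.sq_div_normSq {X Y : ℝ → ℝ} {X' Y' t : ℝ} (hX : HasDerivAt X X' t)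
    (hY : HasDerivAt Y Y' t) (h : X t ^ 2 + Y t ^ 2 ≠ 0) :
    HasDerivAt (fun s => Y s ^ 2 / (X s ^ 2 + Y s ^ 2))
      (2 * (X t * Y t) * (X t * Y' - Y t * X') / (X t ^ 2 + Y t ^ 2) ^ 2) t := by
  refine ((hY.pow 2).div ((hX.pow 2).add (hY.pow 2)) h).congr_deriv ?_
  simp only [Pi.add_apply, Pi.pow_apply]
  congr 1
  push_cast
  ring

open Real in
/-- An antiderivative, in polar coordinates around the singularity, of the Stresslet flux density
along a circle enclosing the singularity. -/
noncomputable def stressletFluxPrimitive (p q r : ℝ) (i j : Fin 2) (θ : ℝ) : ℝ :=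
  if i = j then
    -(1 / (2 * π)) * (circlePolarAngle p q r θ + (if i = 0 then 1 else -1) *
      ((p + r * cos θ) * (q + r * sin θ) / ((p + r * cos θ) ^ 2 + (q + r * sin θ) ^ 2)))
  else
    -(1 / (2 * π)) * ((q + r * sin θ) ^ 2 / ((p + r * cos θ) ^ 2 + (q + r * sin θ) ^ 2))

open Real in
lemma hasDerivAt_stressletFluxPrimitive {c₁ c₂ a b r : ℝ}
    (h : √((c₁ - a) ^ 2 + (c₂ - b) ^ 2) < r) (i j : Fin 2) (θ : ℝ) :
    HasDerivAt (stressletFluxPrimitive (c₁ - a) (c₂ - b) r i j)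
      (∑ k, stresslet a b i j k (c₁ + r * cos θ) (c₂ + r * sin θ) * evec k θ * r) θ := by
  have hx : c₁ + r * cos θ - a = c₁ - a + r * cos θ := by ring
  have hy : c₂ + r * sin θ - b = c₂ - b + r * sin θ := by ring
  have hA := hasDerivAt_circlePolarAngle h θ
  have hD := (normSq_circle_pos h θ).ne'
  have hX : HasDerivAt (fun t => c₁ - a + r * cos t) (r * -sin θ) θ :=
    ((hasDerivAt_cos θ).const_mul r).const_add _
  have hY : HasDerivAt (fun t => c₂ - b + r * sin t) (r * cos θ) θ :=
    ((hasDerivAt_sin θ).const_mul r).const_add _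
  have hM := hX.mul_div_normSq hY hD
  have hS := hX.sq_div_normSq hY hD
  have hdiag (ε : ℝ) := (hA.add (hM.const_mul ε)).const_mul (-(1 / (2 * π)))
  have hoff := hS.const_mul (-(1 / (2 * π)))
  have hpi := pi_ne_zero
  fin_cases i <;> fin_cases j
  · refine (hdiag 1).congr_deriv ?_
    simp [Fin.sum_univ_two, stresslet, xhat, evec, hx, hy]
    generalize c₁ - a + r * cos θ = X at *
    generalize c₂ - b + r * sin θ = Y at *
    field_simp
    ring
  · refine hoff.congr_deriv ?_
    simp [Fin.sum_univ_two, stresslet, xhat, evec, hx, hy]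
    generalize c₁ - a + r * cos θ = X at *
    generalize c₂ - b + r * sin θ = Y at *
    field_simp
    ring
  · refine hoff.congr_deriv ?_
    simp [Fin.sum_univ_two, stresslet, xhat, evec, hx, hy]
    generalize c₁ - a + r * cos θ = X at *
    generalize c₂ - b + r * sin θ = Y at *
    field_simp
    ring
  · refine (hdiag (-1)).congr_deriv ?_
    simp [Fin.sum_univ_two, stresslet, xhat, evec, hx, hy]
    generalize c₁ - a + r * cos θ = X at *
    generalize c₂ - b + r * sin θ = Y at *
    field_simp
    ring

open Real in
lemma continuous_stresslet_flux {c₁ c₂ a b r : ℝ}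
    (h : √((c₁ - a) ^ 2 + (c₂ - b) ^ 2) < r) (i j k : Fin 2) :
    Continuous fun θ =>
      stresslet a b i j k (c₁ + r * cos θ) (c₂ + r * sin θ) * evec k θ * r := by
  have hxhat (l : Fin 2) : Continuous fun θ => xhat a b l (c₁ + r * cos θ) (c₂ + r * sin θ) := by
    unfold xhat
    split_ifs <;> fun_prop
  have hevec : Continuous (evec k) := by
    unfold evec
    split_ifs <;> fun_prop
  unfold stresslet
  refine ((Continuous.div (((hxhat i).mul (hxhat j)).mul (hxhat k)).neg (by fun_prop)
    fun θ => ?_).mul hevec).mul continuous_const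
  have hD := normSq_circle_pos h θ
  rw [sub_add_eq_add_sub, sub_add_eq_add_sub] at hD
  positivity

/-- If the singularity `x₀ = (a, b)` lies strictly inside the circle of radius `r`
centered at `c = (c₁, c₂)`, then the outward flux of the free-space Stresslet through
that circle equals `−δ_ij`:
`∑ₖ ∫₀^{2π} T_ijk(c + r e(θ)) e(θ)ₖ r dθ = −δ_ij`. -/
theorem stresslet_flux_circle_singularity_inside (c₁ c₂ a b r : ℝ) (hr : 0 < r)
    (hin : Real.sqrt ((a - c₁) ^ 2 + (b - c₂) ^ 2) < r) (i j : Fin 2) :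
    (∑ k : Fin 2, ∫ θ in (0:ℝ)..(2 * Real.pi),
      stresslet a b i j k (c₁ + r * Real.cos θ) (c₂ + r * Real.sin θ) * evec k θ * r)
      = -kron i j := by
  have h : √((c₁ - a) ^ 2 + (c₂ - b) ^ 2) < r := by
    rwa [sub_sq_comm c₁ a, sub_sq_comm c₂ b]
  have hint (k : Fin 2) :=
    (continuous_stresslet_flux h i j k).intervalIntegrable (μ := MeasureTheory.volume)
      0 (2 * Real.pi)
  rw [← intervalIntegral.integral_finsetSum fun k _ => hint k,
    intervalIntegral.integral_eq_sub_of_hasDerivAt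
      (fun θ _ => hasDerivAt_stressletFluxPrimitive h i j θ)
      (by simpa only [Finset.sum_fn] using IntervalIntegrable.sum Finset.univ fun k _ => hint k)]
  have hpi := Real.pi_ne_zero
  by_cases hij : i = j
  · simp only [stressletFluxPrimitive, circlePolarAngle, kron, hij, if_true, Real.cos_two_pi,
      Real.sin_two_pi, Real.cos_zero, Real.sin_zero]
    field_simp
    ring
  · simp [stressletFluxPrimitive, kron, hij]
end
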